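/- arXiv:1610.03664 — 7 statements merged into one kernel-verified Lean document; each statement's English description precedes it below -/
import Mathlib

section
/- Let f:ℝⁿ→ℝⁿ be a quadratic vector field f(x)=Q(x)+Bx+c, and fix ε∈ℝ and x∈ℝⁿ such that the matrix I−εf'(x) is invertible. Then a point x̃∈ℝⁿ satisfies the Kahan–Hirota–Kimura relation (x̃−x)/(2ε)=Q(x,x̃)+(1/2)B(x+x̃)+c if and only if x̃ = x + 2ε (I−εf'(x))⁻¹ f(x). In particular the Kahan–Hirota–Kimura discretization defines a map Φ(x,ε)= x + 2ε (I−εf'(x))⁻¹ f(x). -/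
open Matrix

/-- The Jacobian matrix of a vector field `f : ℝⁿ → ℝⁿ` at a point `x`. -/
noncomputable def jacobian {n : ℕ} (f : (Fin n → ℝ) → (Fin n → ℝ)) (x : Fin n → ℝ) :
    Matrix (Fin n) (Fin n) ℝ :=
  Matrix.of fun i j => fderiv ℝ (fun y => f y i) x (Pi.single j 1)

/-- The symmetric bilinear map polarizing the homogeneous quadratic part
`Q(x) i = x ⬝ᵥ (A i *ᵥ x)` of a quadratic vector field:
`Q(x,x̃) = (1/2)(Q(x+x̃) − Q(x) − Q(x̃))`. -/
noncomputable def qpol {n : ℕ} (A : Fin n → Matrix (Fin n) (Fin n) ℝ) (x x' : Fin n → ℝ) :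
    Fin n → ℝ :=
  fun i => (1 / 2 : ℝ) *
    ((x + x') ⬝ᵥ (A i *ᵥ (x + x')) - x ⬝ᵥ (A i *ᵥ x) - x' ⬝ᵥ (A i *ᵥ x'))

lemma dotProduct_mulVec_comm_of_transpose_eq {n : ℕ} {M : Matrix (Fin n) (Fin n) ℝ}
    (hM : Mᵀ = M) (u v : Fin n → ℝ) : v ⬝ᵥ (M *ᵥ u) = u ⬝ᵥ (M *ᵥ v) := by
  rw [dotProduct_mulVec, ← mulVec_transpose, hM, dotProduct_comm]

/-- The polarization of a quadratic form given by symmetric matrices is the associated bilinear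
map. -/
lemma qpol_apply {n : ℕ} {A : Fin n → Matrix (Fin n) (Fin n) ℝ} (hA : ∀ i, (A i)ᵀ = A i)
    (x x' : Fin n → ℝ) (i : Fin n) : qpol A x x' i = x ⬝ᵥ (A i *ᵥ x') := by
  simp only [qpol, mulVec_add, dotProduct_add, add_dotProduct,
    dotProduct_mulVec_comm_of_transpose_eq (hA i) x x']
  ring

/-- The derivative at `x` in the direction `v` of a quadratic function. -/
lemma fderiv_quadratic_apply {n : ℕ} {M : Matrix (Fin n) (Fin n) ℝ} (hM : Mᵀ = M)
    (b : Fin n → ℝ) (c : ℝ) (x v : Fin n → ℝ) :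
    fderiv ℝ (fun y => y ⬝ᵥ (M *ᵥ y) + b ⬝ᵥ y + c) x v = 2 * (x ⬝ᵥ (M *ᵥ v)) + b ⬝ᵥ v := by
  have hd : DifferentiableAt ℝ (fun y : Fin n → ℝ => y ⬝ᵥ (M *ᵥ y) + b ⬝ᵥ y + c) x := by
    simp only [dotProduct, mulVec]
    fun_prop
  rw [← hd.lineDeriv_eq_fderiv, lineDeriv]
  have hline : (fun t : ℝ => (x + t • v) ⬝ᵥ (M *ᵥ (x + t • v)) + b ⬝ᵥ (x + t • v) + c) =
      fun t => (x ⬝ᵥ (M *ᵥ x) + b ⬝ᵥ x + c) + t * (2 * (x ⬝ᵥ (M *ᵥ v)) + b ⬝ᵥ v) +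
        t ^ 2 * (v ⬝ᵥ (M *ᵥ v)) := by
    funext t
    simp only [mulVec_add, mulVec_smul, dotProduct_add, add_dotProduct, dotProduct_smul,
      smul_dotProduct, smul_eq_mul, dotProduct_mulVec_comm_of_transpose_eq hM x v]
    ring
  rw [hline]
  have h := (((hasDerivAt_id (0 : ℝ)).mul_const (2 * (x ⬝ᵥ (M *ᵥ v)) + b ⬝ᵥ v)).const_add
    (x ⬝ᵥ (M *ᵥ x) + b ⬝ᵥ x + c)).add
    (((hasDerivAt_id (0 : ℝ)).pow 2).mul_const (v ⬝ᵥ (M *ᵥ v)))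
  refine h.deriv.trans ?_
  simp

/-- The Jacobian of a quadratic vector field acts by `v ↦ 2 Q(x, v) + B v`. -/
lemma jacobian_quadratic_mulVec {n : ℕ} {A : Fin n → Matrix (Fin n) (Fin n) ℝ}
    (hA : ∀ i, (A i)ᵀ = A i) (B : Matrix (Fin n) (Fin n) ℝ) (c x v : Fin n → ℝ) :
    jacobian (fun y i => y ⬝ᵥ (A i *ᵥ y) + (B *ᵥ y) i + c i) x *ᵥ v =
      (2 : ℝ) • qpol A x v + B *ᵥ v := by
  have hJ : jacobian (fun y i => y ⬝ᵥ (A i *ᵥ y) + (B *ᵥ y) i + c i) x =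
      Matrix.of fun i => (2 : ℝ) • (x ᵥ* A i) + B i := by
    ext i j
    refine (fderiv_quadratic_apply (hA i) (B i) (c i) x (Pi.single j 1)).trans ?_
    simp
    rfl
  ext i
  rw [hJ, Pi.add_apply, Pi.smul_apply, qpol_apply hA, dotProduct_mulVec]
  change ((2 : ℝ) • (x ᵥ* A i) + B i) ⬝ᵥ v = _
  rw [add_dotProduct, smul_dotProduct]
  rfl

/-- for a quadratic vector field `f(x) = Q(x) + Bx + c`, `ε ≠ 0` and a point
`x` where `I − ε f'(x)` is invertible, a point `x̃` satisfies the Kahan–Hirota–Kimura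
relation `(x̃−x)/(2ε) = Q(x,x̃) + (1/2)B(x+x̃) + c` if and only if
`x̃ = x + 2ε (I − ε f'(x))⁻¹ f(x)`. -/
theorem khk_explicit_form (n : ℕ) (A : Fin n → Matrix (Fin n) (Fin n) ℝ)
    (hA : ∀ i, (A i)ᵀ = A i)
    (B : Matrix (Fin n) (Fin n) ℝ) (c : Fin n → ℝ)
    (f : (Fin n → ℝ) → (Fin n → ℝ))
    (hf : f = fun x i => x ⬝ᵥ (A i *ᵥ x) + (B *ᵥ x) i + c i)
    (ε : ℝ) (hε : ε ≠ 0) (x : Fin n → ℝ)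
    (hinv : IsUnit (1 - ε • jacobian f x).det)
    (x' : Fin n → ℝ) :
    (2 * ε)⁻¹ • (x' - x) = qpol A x x' + (2 : ℝ)⁻¹ • (B *ᵥ (x + x')) + c ↔
      x' = x + (2 * ε) • ((1 - ε • jacobian f x)⁻¹ *ᵥ f x) := by
  subst hf
  set J := jacobian (fun x i => x ⬝ᵥ (A i *ᵥ x) + (B *ᵥ x) i + c i) x with hJ
  set F : Fin n → ℝ := fun i => x ⬝ᵥ (A i *ᵥ x) + (B *ᵥ x) i + c i with hF
  have hrhs : qpol A x x' + (2 : ℝ)⁻¹ • (B *ᵥ (x + x')) + c =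
      F + (2 : ℝ)⁻¹ • (J *ᵥ (x' - x)) := by
    rw [hJ, jacobian_quadratic_mulVec hA]
    ext i
    simp only [hF, Pi.add_apply, Pi.smul_apply, qpol_apply hA, mulVec_add, mulVec_sub,
      dotProduct_sub, Pi.sub_apply, smul_eq_mul]
    ring
  have hsolve : x' = x + (2 * ε) • ((1 - ε • J)⁻¹ *ᵥ F) ↔
      (1 - ε • J) *ᵥ (x' - x) = (2 * ε) • F := by
    rw [← sub_eq_iff_eq_add', ← mulVec_smul]
    constructor
    · intro h
      rw [h, mulVec_mulVec, mul_nonsing_inv _ hinv, one_mulVec]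
    · intro h
      rw [← h, mulVec_mulVec, nonsing_inv_mul _ hinv, one_mulVec]
  rw [hrhs, hsolve, inv_smul_eq_iff₀ (mul_ne_zero two_ne_zero hε), sub_mulVec, one_mulVec,
    smul_mulVec, sub_eq_iff_eq_add (a := x' - x), smul_add, smul_smul, mul_right_comm,
    mul_inv_cancel₀ two_ne_zero, one_mul]
end

section
/- Let f:ℝⁿ→ℝⁿ be a quadratic vector field f(x)=Q(x)+Bx+c and let v∈ℝⁿ be such that vᵀf(x)=0 for all x∈ℝⁿ (i.e., the linear form V(x)=vᵀx is a first integral of ẋ=f(x)). Then for every ε∈ℝ and every pair x,x̃∈ℝⁿ satisfying the Kahan–Hirota–Kimura relation (x̃−x)/(2ε)=Q(x,x̃)+(1/2)B(x+x̃)+c, one has vᵀx̃ = vᵀx. That is, the Kahan–Hirota–Kimura discretization preserves all linear integrals of motion. -/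
open Matrix

/-- the Kahan–Hirota–Kimura discretization of a quadratic vector field
`f(x) = Q(x) + Bx + c` preserves every linear integral of motion `V(x) = vᵀx`
(i.e. with `vᵀ f(x) = 0` for all `x`): if `x, x̃` satisfy the KHK relation
`(x̃ − x)/(2ε) = Q(x,x̃) + (1/2)B(x+x̃) + c`, then `vᵀx̃ = vᵀx`. -/
theorem khk_preserves_linear_integrals (n : ℕ) (A : Fin n → Matrix (Fin n) (Fin n) ℝ)
    (hA : ∀ i, (A i)ᵀ = A i)
    (B : Matrix (Fin n) (Fin n) ℝ) (c : Fin n → ℝ)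
    (f : (Fin n → ℝ) → (Fin n → ℝ))
    (hf : f = fun x i => x ⬝ᵥ (A i *ᵥ x) + (B *ᵥ x) i + c i)
    (v : Fin n → ℝ) (hv : ∀ x, v ⬝ᵥ f x = 0)
    (ε : ℝ) (x x' : Fin n → ℝ)
    (hkhk : x' - x = (2 * ε) • (qpol A x x' + (2 : ℝ)⁻¹ • (B *ᵥ (x + x')) + c)) :
    v ⬝ᵥ x' = v ⬝ᵥ x := by
  -- The right-hand side of the KHK relation is a linear combination of values of `f`.
  have key : qpol A x x' + (2 : ℝ)⁻¹ • (B *ᵥ (x + x')) + c =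
      (1 / 2 : ℝ) • (f (x + x') - f x - f x') +
        (1 / 4 : ℝ) • (f (x + x') - f (-(x + x'))) + (3 / 2 : ℝ) • f 0 := by
    subst hf
    ext i
    simp only [qpol, Pi.add_apply, Pi.sub_apply, Pi.smul_apply, smul_eq_mul, mulVec_neg,
      neg_dotProduct_neg, Pi.neg_apply, mulVec_zero, dotProduct_zero, Pi.zero_apply]
    rw [show (B *ᵥ (x + x')) i = (B *ᵥ x) i + (B *ᵥ x') i by rw [mulVec_add, Pi.add_apply]]
    ring
  rw [← sub_eq_zero, ← dotProduct_sub, hkhk, key]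
  simp [dotProduct_add, dotProduct_sub, dotProduct_smul, hv]
end

section
/- Let ℓ₁,ℓ₂,ℓ₃ be linear forms on ℝⁿ with ℓᵢ(x)=aᵢᵀx, let J be a skew-symmetric real n×n matrix, a,b,c∈ℝ, and f(x)=J( a ℓ₂(x)ℓ₃(x) a₁ + b ℓ₁(x)ℓ₃(x) a₂ + c ℓ₁(x)ℓ₂(x) a₃ ). Then the measure with density 1/(ℓ₁ℓ₂ℓ₃) is invariant under the flow of ẋ=f(x); equivalently, the polynomial identity ℓ₁(x)ℓ₂(x)ℓ₃(x)·div f(x) = f(x)ᵀ∇(ℓ₁ℓ₂ℓ₃)(x) holds for all x∈ℝⁿ, i.e. the divergence of the vector field f(x)/(ℓ₁(x)ℓ₂(x)ℓ₃(x)) vanishes wherever ℓ₁(x)ℓ₂(x)ℓ₃(x)≠0. -/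
open Matrix

/-- The divergence `Σᵢ ∂fᵢ/∂xᵢ` of a vector field on ℝⁿ. -/
noncomputable def divergence {n : ℕ} (f : (Fin n → ℝ) → (Fin n → ℝ)) (x : Fin n → ℝ) : ℝ :=
  ∑ i, fderiv ℝ (fun y => f y i) x (Pi.single i 1)

theorem divergence_add {n : ℕ} {f g : (Fin n → ℝ) → (Fin n → ℝ)} {x : Fin n → ℝ}
    (hf : DifferentiableAt ℝ f x) (hg : DifferentiableAt ℝ g x) :
    divergence (fun y => f y + g y) x = divergence f x + divergence g x := by
  rw [differentiableAt_pi] at hf hg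
  simp only [divergence, Pi.add_apply, ← Finset.sum_add_distrib]
  refine Finset.sum_congr rfl fun i _ => ?_
  rw [fderiv_fun_add (hf i) (hg i), _root_.add_apply]

/-- The product rule `div (g f) = g div f + f · ∇g`. -/
theorem divergence_smul {n : ℕ} {g : (Fin n → ℝ) → ℝ} {f : (Fin n → ℝ) → (Fin n → ℝ)}
    {x : Fin n → ℝ} (hg : DifferentiableAt ℝ g x) (hf : DifferentiableAt ℝ f x) :
    divergence (fun y => g y • f y) x = g x * divergence f x + fderiv ℝ g x (f x) := by
  rw [differentiableAt_pi] at hf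
  have hsum : fderiv ℝ g x (f x) = ∑ i, f x i * fderiv ℝ g x (Pi.single i 1) := by
    conv_lhs => rw [pi_eq_sum_univ' (f x)]
    simp [map_sum]
  rw [hsum]
  simp only [divergence, Pi.smul_apply, smul_eq_mul, Finset.mul_sum, ← Finset.sum_add_distrib]
  refine Finset.sum_congr rfl fun i _ => ?_
  rw [fderiv_fun_mul hg (hf i)]
  simp

theorem divergence_smul_const {n : ℕ} {g : (Fin n → ℝ) → ℝ} {x : Fin n → ℝ}
    (hg : DifferentiableAt ℝ g x) (v : Fin n → ℝ) :
    divergence (fun y => g y • v) x = fderiv ℝ g x v := by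
  rw [divergence_smul hg (differentiableAt_const v)]
  simp [divergence]

theorem hasFDerivAt_dotProduct {n : ℕ} (v x : Fin n → ℝ) :
    HasFDerivAt (fun y => v ⬝ᵥ y) (dotProductBilin ℝ ℝ v).toContinuousLinearMap x :=
  (dotProductBilin ℝ ℝ v).toContinuousLinearMap.hasFDerivAt

theorem differentiableAt_dotProduct {n : ℕ} (v x : Fin n → ℝ) :
    DifferentiableAt ℝ (fun y => v ⬝ᵥ y) x :=
  (hasFDerivAt_dotProduct v x).differentiableAt

theorem fderiv_const_mul_dotProduct_mul_dotProduct {n : ℕ} (r : ℝ) (u v x w : Fin n → ℝ) :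
    fderiv ℝ (fun y => r * (u ⬝ᵥ y) * (v ⬝ᵥ y)) x w =
      r * ((u ⬝ᵥ w) * (v ⬝ᵥ x) + (u ⬝ᵥ x) * (v ⬝ᵥ w)) := by
  rw [(((hasFDerivAt_dotProduct u x).const_mul r).fun_mul (hasFDerivAt_dotProduct v x)).fderiv]
  simp
  ring

theorem fderiv_dotProduct_mul_dotProduct_mul_dotProduct {n : ℕ} (u v z x w : Fin n → ℝ) :
    fderiv ℝ (fun y => (u ⬝ᵥ y) * (v ⬝ᵥ y) * (z ⬝ᵥ y)) x w =
      (u ⬝ᵥ w) * (v ⬝ᵥ x) * (z ⬝ᵥ x) + (u ⬝ᵥ x) * (v ⬝ᵥ w) * (z ⬝ᵥ x) +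
        (u ⬝ᵥ x) * (v ⬝ᵥ x) * (z ⬝ᵥ w) := by
  rw [(((hasFDerivAt_dotProduct u x).fun_mul (hasFDerivAt_dotProduct v x)).fun_mul
    (hasFDerivAt_dotProduct z x)).fderiv]
  simp
  ring

theorem dotProduct_mulVec_self_of_transpose_eq_neg {n : ℕ} {J : Matrix (Fin n) (Fin n) ℝ}
    (hJ : Jᵀ = -J) (v : Fin n → ℝ) : v ⬝ᵥ (J *ᵥ v) = 0 := by
  have h : v ⬝ᵥ (J *ᵥ v) = -(v ⬝ᵥ (J *ᵥ v)) := by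
    conv_lhs => rw [dotProduct_mulVec, ← mulVec_transpose, hJ, neg_mulVec, neg_dotProduct,
      dotProduct_comm]
  linarith

/-- for linear forms `ℓᵢ(x) = aᵢᵀx`, a skew-symmetric matrix `J` and
`a, b, c ∈ ℝ`, the vector field `f(x) = J(a ℓ₂ℓ₃ a₁ + b ℓ₁ℓ₃ a₂ + c ℓ₁ℓ₂ a₃)`
preserves the measure with density `1/(ℓ₁ℓ₂ℓ₃)`: the polynomial identity
`ℓ₁ℓ₂ℓ₃ · div f = fᵀ ∇(ℓ₁ℓ₂ℓ₃)` holds on all of ℝⁿ, i.e. the divergence of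
`f/(ℓ₁ℓ₂ℓ₃)` vanishes wherever `ℓ₁ℓ₂ℓ₃ ≠ 0`. -/
theorem nahm_invariant_measure (n : ℕ) (a₁ a₂ a₃ : Fin n → ℝ)
    (J : Matrix (Fin n) (Fin n) ℝ) (hJ : Jᵀ = -J) (a b c : ℝ)
    (f : (Fin n → ℝ) → (Fin n → ℝ))
    (hf : f = fun x => J *ᵥ ((a * (a₂ ⬝ᵥ x) * (a₃ ⬝ᵥ x)) • a₁ +
      (b * (a₁ ⬝ᵥ x) * (a₃ ⬝ᵥ x)) • a₂ + (c * (a₁ ⬝ᵥ x) * (a₂ ⬝ᵥ x)) • a₃)) :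
    (∀ x : Fin n → ℝ,
      (a₁ ⬝ᵥ x) * (a₂ ⬝ᵥ x) * (a₃ ⬝ᵥ x) * divergence f x =
        fderiv ℝ (fun y => (a₁ ⬝ᵥ y) * (a₂ ⬝ᵥ y) * (a₃ ⬝ᵥ y)) x (f x)) ∧
    (∀ x : Fin n → ℝ, (a₁ ⬝ᵥ x) * (a₂ ⬝ᵥ x) * (a₃ ⬝ᵥ x) ≠ 0 →
      divergence (fun y => ((a₁ ⬝ᵥ y) * (a₂ ⬝ᵥ y) * (a₃ ⬝ᵥ y))⁻¹ • f y) x = 0) := by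
  have hl : ∀ v x : Fin n → ℝ, DifferentiableAt ℝ (fun y => v ⬝ᵥ y) x :=
    differentiableAt_dotProduct
  have hq : ∀ (r : ℝ) (u v x : Fin n → ℝ),
      DifferentiableAt ℝ (fun y => r * (u ⬝ᵥ y) * (v ⬝ᵥ y)) x :=
    fun r u v x => ((hl u x).const_mul r).mul (hl v x)
  have hqs : ∀ (r : ℝ) (u v w x : Fin n → ℝ),
      DifferentiableAt ℝ (fun y => (r * (u ⬝ᵥ y) * (v ⬝ᵥ y)) • w) x :=
    fun r u v w x => (hq r u v x).smul_const w
  simp only [mulVec_add, mulVec_smul] at hf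
  have hfd : ∀ x, DifferentiableAt ℝ f x := fun x => by
    rw [hf]
    exact ((hqs _ _ _ _ x).add (hqs _ _ _ _ x)).add (hqs _ _ _ _ x)
  have key : ∀ x : Fin n → ℝ,
      (a₁ ⬝ᵥ x) * (a₂ ⬝ᵥ x) * (a₃ ⬝ᵥ x) * divergence f x =
        fderiv ℝ (fun y => (a₁ ⬝ᵥ y) * (a₂ ⬝ᵥ y) * (a₃ ⬝ᵥ y)) x (f x) := fun x => by
    have hdiv : divergence f x =
        fderiv ℝ (fun y => a * (a₂ ⬝ᵥ y) * (a₃ ⬝ᵥ y)) x (J *ᵥ a₁) +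
          fderiv ℝ (fun y => b * (a₁ ⬝ᵥ y) * (a₃ ⬝ᵥ y)) x (J *ᵥ a₂) +
          fderiv ℝ (fun y => c * (a₁ ⬝ᵥ y) * (a₂ ⬝ᵥ y)) x (J *ᵥ a₃) := by
      rw [hf, divergence_add ((hqs _ _ _ _ x).fun_add (hqs _ _ _ _ x)) (hqs _ _ _ _ x),
        divergence_add (hqs _ _ _ _ x) (hqs _ _ _ _ x), divergence_smul_const (hq _ _ _ x),
        divergence_smul_const (hq _ _ _ x), divergence_smul_const (hq _ _ _ x)]
    rw [hdiv, hf]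
    simp only [fderiv_const_mul_dotProduct_mul_dotProduct,
      fderiv_dotProduct_mul_dotProduct_mul_dotProduct, dotProduct_add, dotProduct_smul,
      smul_eq_mul, dotProduct_mulVec_self_of_transpose_eq_neg hJ]
    ring
  refine ⟨key, fun x hx => ?_⟩
  have hP : DifferentiableAt ℝ (fun y => (a₁ ⬝ᵥ y) * (a₂ ⬝ᵥ y) * (a₃ ⬝ᵥ y)) x :=
    ((hl a₁ x).mul (hl a₂ x)).mul (hl a₃ x)
  have hinv := (hasDerivAt_inv hx).comp_hasFDerivAt x hP.hasFDerivAt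
  have hdiv := divergence_smul hinv.differentiableAt (hfd x)
  rw [hinv.fderiv] at hdiv
  refine hdiv.trans ?_
  simp only [_root_.smul_apply, Function.comp_apply, smul_eq_mul, ← key x]
  field_simp
  ring
end

section
/- Let ℓ₁,ℓ₂ be linear forms on ℝⁿ with ℓᵢ(x)=aᵢᵀx, let J be a skew-symmetric real n×n matrix, α,β∈ℝ, and set a₃=αa₁+βa₂, ℓ₃=αℓ₁+βℓ₂, λ=a₁ᵀJa₂. Consider the vector field f(x)=J( ℓ₂ℓ₃ a₁ + ℓ₁ℓ₃ a₂ + 2 ℓ₁ℓ₂ a₃ ), whose Kahan–Hirota–Kimura discretization reads x̃−x = εJ( (3α(ℓ₁ℓ̃₂+ℓ̃₁ℓ₂)+2βℓ₂ℓ̃₂) a₁ + (3β(ℓ₁ℓ̃₂+ℓ̃₁ℓ₂)+2αℓ₁ℓ̃₁) a₂ ), with ℓ̃ᵢ=ℓᵢ(x̃). Then the map admits the conserved quantity H_ε = H/(1+ε²P₂+ε⁴P₄), where H=ℓ₁ℓ₂ℓ₃², P₂ = −2λ²(5α²ℓ₁²+6αβℓ₁ℓ₂+5β²ℓ₂²)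 and P₄ = λ⁴(9α⁴ℓ₁⁴−2α²β²ℓ₁²ℓ₂²+9β⁴ℓ₂⁴). Precisely, for any x,x̃ satisfying the discretization relation, H(x̃)·(1+ε²P₂(x)+ε⁴P₄(x)) = H(x)·(1+ε²P₂(x̃)+ε⁴P₄(x̃)). -/
open Matrix

/-- The bilinear form of a skew-symmetric matrix is antisymmetric. -/
theorem dotProduct_mulVec_swap_of_skew {n : ℕ} {J : Matrix (Fin n) (Fin n) ℝ} (hJ : Jᵀ = -J)
    (a b : Fin n → ℝ) : a ⬝ᵥ (J *ᵥ b) = -(b ⬝ᵥ (J *ᵥ a)) := by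
  rw [dotProduct_mulVec, ← mulVec_transpose, hJ, neg_mulVec, neg_dotProduct, dotProduct_comm]

/-- The planar form of the conservation law: two scalars `u`, `v` evolving by the reduced
discretization with effective step `k`. -/
theorem planar_khk_conserved (α β k u v u' v' : ℝ)
    (hu : u' - u = k * (3 * β * (u * v' + u' * v) + 2 * α * u * u'))
    (hv : v' - v = -(k * (3 * α * (u * v' + u' * v) + 2 * β * v * v'))) :
    u' * v' * (α * u' + β * v') ^ 2 *
        (1 - 2 * k ^ 2 * (5 * α ^ 2 * u ^ 2 + 6 * α * β * u * v + 5 * β ^ 2 * v ^ 2) +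
          k ^ 4 * (9 * α ^ 4 * u ^ 4 - 2 * α ^ 2 * β ^ 2 * u ^ 2 * v ^ 2 + 9 * β ^ 4 * v ^ 4)) =
      u * v * (α * u + β * v) ^ 2 *
        (1 - 2 * k ^ 2 * (5 * α ^ 2 * u' ^ 2 + 6 * α * β * u' * v' + 5 * β ^ 2 * v' ^ 2) +
          k ^ 4 * (9 * α ^ 4 * u' ^ 4 - 2 * α ^ 2 * β ^ 2 * u' ^ 2 * v' ^ 2 +
            9 * β ^ 4 * v' ^ 4)) := by
  obtain ⟨p, hp⟩ : ∃ p, p = k * α * u := ⟨_, rfl⟩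
  obtain ⟨q, hq⟩ : ∃ q, q = k * β * v := ⟨_, rfl⟩
  obtain ⟨d, hd⟩ : ∃ d, d = 1 + p - q - 4 * p * q - 6 * p ^ 2 - 6 * q ^ 2 := ⟨_, rfl⟩
  have hdu : d * u' = u * (1 + 3 * p + 5 * q) := by
    subst hd hp hq
    linear_combination (1 + 3 * k * α * u + 2 * k * β * v) * hu + 3 * k * β * u * hv
  have hdv : d * v' = v * (1 - 5 * p - 3 * q) := by
    subst hd hp hq
    linear_combination (1 - 3 * k * β * v - 2 * k * α * u) * hv - 3 * k * α * v * hu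
  have hD : 1 - 2 * k ^ 2 * (5 * α ^ 2 * u ^ 2 + 6 * α * β * u * v + 5 * β ^ 2 * v ^ 2) +
      k ^ 4 * (9 * α ^ 4 * u ^ 4 - 2 * α ^ 2 * β ^ 2 * u ^ 2 * v ^ 2 + 9 * β ^ 4 * v ^ 4) =
      1 - 2 * (5 * p ^ 2 + 6 * p * q + 5 * q ^ 2) +
        (9 * p ^ 4 - 2 * p ^ 2 * q ^ 2 + 9 * q ^ 4) := by
    subst hp hq; ring
  rw [hD]
  by_cases h0 : d = 0
  · -- The step is not solvable for `(u', v')`; both `H` and the denominator vanish at `(u, v)`.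
    rw [h0, zero_mul] at hdu hdv
    rw [h0] at hd
    have key : u * v * (α * u + β * v) ^ 2 = 0 ∧
        1 - 2 * (5 * p ^ 2 + 6 * p * q + 5 * q ^ 2) +
          (9 * p ^ 4 - 2 * p ^ 2 * q ^ 2 + 9 * q ^ 4) = 0 := by
      rcases mul_eq_zero.mp hdu.symm with h1 | h1 <;> rcases mul_eq_zero.mp hdv.symm with h2 | h2
      · simp [hp, hq, h1, h2] at hd
      · have hp0 : p = 0 := by simp [hp, h1]
        have hq0 : q = 1 / 3 := by linarith
        exact ⟨by simp [h1], by rw [hp0, hq0]; norm_num⟩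
      · have hq0 : q = 0 := by simp [hq, h2]
        have hp0 : p = -1 / 3 := by linarith
        exact ⟨by simp [h2], by rw [hp0, hq0]; norm_num⟩
      · have hp0 : p = 1 / 2 := by linarith
        have hq0 : q = -1 / 2 := by linarith
        have hk : k ≠ 0 := by
          rintro rfl
          norm_num [hp0] at hp
        have hs : α * u + β * v = 0 := by
          apply mul_left_cancel₀ hk
          linarith
        exact ⟨by simp [hs], by rw [hp0, hq0]; norm_num⟩
    rw [key.1, key.2, mul_zero, zero_mul]
  · have hw : d * (α * u' + β * v') = (α * u + β * v) * (1 + 3 * p - 3 * q) := by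
      rw [mul_add, mul_left_comm, hdu, mul_left_comm d β, hdv]
      subst hp hq; ring
    have hP : d * (k * α * u') = p * (1 + 3 * p + 5 * q) := by
      rw [mul_left_comm, hdu, hp]; ring
    have hQ : d * (k * β * v') = q * (1 - 5 * p - 3 * q) := by
      rw [mul_left_comm, hdv, hq]; ring
    apply mul_left_cancel₀ (pow_ne_zero 4 h0)
    calc _ = d * u' * (d * v') * (d * (α * u' + β * v')) ^ 2 *
          (1 - 2 * (5 * p ^ 2 + 6 * p * q + 5 * q ^ 2) +
            (9 * p ^ 4 - 2 * p ^ 2 * q ^ 2 + 9 * q ^ 4)) := by ring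
      _ = u * v * (α * u + β * v) ^ 2 *
          (d ^ 4 - 2 * d ^ 2 * (5 * (d * (k * α * u')) ^ 2 +
              6 * (d * (k * α * u')) * (d * (k * β * v')) + 5 * (d * (k * β * v')) ^ 2) +
            (9 * (d * (k * α * u')) ^ 4 -
              2 * (d * (k * α * u')) ^ 2 * (d * (k * β * v')) ^ 2 +
              9 * (d * (k * β * v')) ^ 4)) := by
        rw [hdu, hdv, hw, hP, hQ, hd]; ring
      _ = _ := by ring

/-- conserved quantity of the Kahan–Hirota–Kimura discretization of
the system with exponents `(a,b,c) = (1,1,2)` and `ℓ₃ = αℓ₁ + βℓ₂`: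
for `H = ℓ₁ℓ₂ℓ₃²`, `λ = a₁ᵀJa₂`,
`P₂ = −2λ²(5α²ℓ₁² + 6αβℓ₁ℓ₂ + 5β²ℓ₂²)` and
`P₄ = λ⁴(9α⁴ℓ₁⁴ − 2α²β²ℓ₁²ℓ₂² + 9β⁴ℓ₂⁴)`, the quantity
`H_ε = H/(1 + ε²P₂ + ε⁴P₄)` is conserved, i.e.
`H(x̃)(1 + ε²P₂(x) + ε⁴P₄(x)) = H(x)(1 + ε²P₂(x̃) + ε⁴P₄(x̃))`. -/
theorem khk_nahm_112_conserved (n : ℕ) (a₁ a₂ : Fin n → ℝ)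
    (J : Matrix (Fin n) (Fin n) ℝ) (hJ : Jᵀ = -J) (α β : ℝ)
    (a₃ : Fin n → ℝ) (ha₃ : a₃ = α • a₁ + β • a₂)
    (lam : ℝ) (hlam : lam = a₁ ⬝ᵥ (J *ᵥ a₂))
    (ℓ₁ ℓ₂ ℓ₃ : (Fin n → ℝ) → ℝ)
    (hℓ₁ : ℓ₁ = fun x => a₁ ⬝ᵥ x) (hℓ₂ : ℓ₂ = fun x => a₂ ⬝ᵥ x)
    (hℓ₃ : ℓ₃ = fun x => a₃ ⬝ᵥ x)
    (H : (Fin n → ℝ) → ℝ) (hH : H = fun x => ℓ₁ x * ℓ₂ x * (ℓ₃ x) ^ 2)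
    (P₂ P₄ : (Fin n → ℝ) → ℝ)
    (hP₂ : P₂ = fun x => -2 * lam ^ 2 *
      (5 * α ^ 2 * (ℓ₁ x) ^ 2 + 6 * α * β * ℓ₁ x * ℓ₂ x + 5 * β ^ 2 * (ℓ₂ x) ^ 2))
    (hP₄ : P₄ = fun x => lam ^ 4 *
      (9 * α ^ 4 * (ℓ₁ x) ^ 4 - 2 * α ^ 2 * β ^ 2 * (ℓ₁ x) ^ 2 * (ℓ₂ x) ^ 2 +
        9 * β ^ 4 * (ℓ₂ x) ^ 4))
    (ε : ℝ) (x x' : Fin n → ℝ)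
    (hkhk : x' - x = ε • (J *ᵥ
      ((3 * α * (ℓ₁ x * ℓ₂ x' + ℓ₁ x' * ℓ₂ x) + 2 * β * ℓ₂ x * ℓ₂ x') • a₁ +
       (3 * β * (ℓ₁ x * ℓ₂ x' + ℓ₁ x' * ℓ₂ x) + 2 * α * ℓ₁ x * ℓ₁ x') • a₂))) :
    H x' * (1 + ε ^ 2 * P₂ x + ε ^ 4 * P₄ x) =
      H x * (1 + ε ^ 2 * P₂ x' + ε ^ 4 * P₄ x') := by
  have h11 : a₁ ⬝ᵥ (J *ᵥ a₁) = 0 := by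
    linarith [dotProduct_mulVec_swap_of_skew hJ a₁ a₁]
  have h22 : a₂ ⬝ᵥ (J *ᵥ a₂) = 0 := by
    linarith [dotProduct_mulVec_swap_of_skew hJ a₂ a₂]
  have h21 : a₂ ⬝ᵥ (J *ᵥ a₁) = -lam := by
    rw [hlam, dotProduct_mulVec_swap_of_skew hJ]
  have e1 := congrArg (a₁ ⬝ᵥ ·) hkhk
  have e2 := congrArg (a₂ ⬝ᵥ ·) hkhk
  simp only [dotProduct_sub, dotProduct_smul, mulVec_add, mulVec_smul, dotProduct_add,
    smul_eq_mul, h11, h22, h21, ← hlam] at e1 e2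
  subst hℓ₁ hℓ₂ hℓ₃ hH hP₂ hP₄ ha₃
  simp only [add_dotProduct, smul_dotProduct, smul_eq_mul] at e1 e2 ⊢
  linear_combination planar_khk_conserved α β (ε * lam) (a₁ ⬝ᵥ x) (a₂ ⬝ᵥ x) (a₁ ⬝ᵥ x') (a₂ ⬝ᵥ x')
    (by linear_combination e1) (by linear_combination e2)
end

section
/- Let n≥3, let ℓ₁,ℓ₂ be linear forms on ℝⁿ with ℓᵢ(x)=aᵢᵀx, let K(x)=(1/2)xᵀCx be a quadratic form (C symmetric), and let v₁,…,v_{n−3}∈ℝⁿ. Consider the vector field f with wᵀf(x)=det(w,v₁,…,v_{n−3}, ℓ₂(x)a₁+ℓ₁(x)a₂, Cx) for all w∈ℝⁿ, and suppose x,x̃∈ℝⁿ satisfy its Kahan–Hirota–Kimura relation, i.e. for all w∈ℝⁿ: wᵀ(x̃−x) = ε[ det(w,v₁,…,v_{n−3}, ℓ₂(x)a₁+ℓ₁(x)a₂, Cx̃) + det(w,v₁,…,v_{n−3}, ℓ₂(x̃)a₁+ℓ₁(x̃)a₂, Cx) ]. Set Δ(x)=det(a₁,v₁,…,v_{n−3},a₂,Cx).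 Then ℓ₁(x̃)(1−εΔ(x)) = ℓ₁(x)(1+εΔ(x̃)) and ℓ₂(x̃)(1+εΔ(x)) = ℓ₂(x)(1−εΔ(x̃)); consequently ℓ₁(x̃)ℓ₂(x̃)·(1−ε²Δ(x)²) = ℓ₁(x)ℓ₂(x)·(1−ε²Δ(x̃)²), i.e. H_ε = ℓ₁ℓ₂/(1−ε²Δ²) is a conserved quantity of the Kahan–Hirota–Kimura map. Moreover vᵢᵀx̃=vᵢᵀx for i=1,…,n−3. -/
open Matrix

/-- `colDet w v u₁ u₂` is the determinant of the `n×n` matrix (`n = m+3`) whose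
columns are `w, v 0, …, v (m−1), u₁, u₂`, in this order. -/
def colDet {m : ℕ} (w : Fin (m + 3) → ℝ) (v : Fin m → Fin (m + 3) → ℝ)
    (u₁ u₂ : Fin (m + 3) → ℝ) : ℝ :=
  Matrix.det (Matrix.of fun i j =>
    (Fin.cons w (Fin.snoc (Fin.snoc v u₁) u₂) : Fin (m + 3) → Fin (m + 3) → ℝ) j i)

/-- The index of the column `u₁` in `colDet w v u₁ u₂`. -/
def penultimateCol (m : ℕ) : Fin (m + 3) := (Fin.last m).castSucc.succ

lemma colDet_eq_detRowAlternating {m : ℕ} (w : Fin (m + 3) → ℝ) (v : Fin m → Fin (m + 3) → ℝ)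
    (u₁ u₂ : Fin (m + 3) → ℝ) :
    colDet w v u₁ u₂ = Matrix.detRowAlternating
      (Fin.cons w (Fin.snoc (Fin.snoc v u₁) u₂) : Fin (m + 3) → Fin (m + 3) → ℝ) :=
  Matrix.det_transpose _

lemma update_cons_snoc_snoc {m : ℕ} {α : Type*} (w u₁ u₂ u : α) (v : Fin m → α) :
    Function.update (Fin.cons w (Fin.snoc (Fin.snoc v u₁) u₂) : Fin (m + 3) → α)
      (penultimateCol m) u = Fin.cons w (Fin.snoc (Fin.snoc v u) u₂) := by
  rw [penultimateCol, ← Fin.cons_update, ← Fin.snoc_update, Fin.update_snoc_last]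

lemma cons_snoc_snoc_penultimateCol {m : ℕ} {α : Type*} (w u₁ u₂ : α) (v : Fin m → α) :
    (Fin.cons w (Fin.snoc (Fin.snoc v u₁) u₂) : Fin (m + 3) → α) (penultimateCol m) = u₁ := by
  rw [penultimateCol, Fin.cons_succ, Fin.snoc_castSucc (α := fun _ => α),
    Fin.snoc_last (α := fun _ => α)]

lemma colDet_smul_add_smul {m : ℕ} (w : Fin (m + 3) → ℝ) (v : Fin m → Fin (m + 3) → ℝ)
    (s t : ℝ) (b c u₂ : Fin (m + 3) → ℝ) :
    colDet w v (s • b + t • c) u₂ = s * colDet w v b u₂ + t * colDet w v c u₂ := by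
  simp only [colDet_eq_detRowAlternating]
  rw [← update_cons_snoc_snoc w 0 u₂ (s • b + t • c) v, AlternatingMap.map_update_add,
    AlternatingMap.map_update_smul, AlternatingMap.map_update_smul]
  simp only [update_cons_snoc_snoc, smul_eq_mul]

lemma colDet_self {m : ℕ} (w : Fin (m + 3) → ℝ) (v : Fin m → Fin (m + 3) → ℝ)
    (u₂ : Fin (m + 3) → ℝ) : colDet w v w u₂ = 0 := by
  rw [colDet_eq_detRowAlternating]
  refine AlternatingMap.map_eq_zero_of_eq _ _ (i := 0) (j := penultimateCol m) ?_
    (Fin.succ_ne_zero _).symm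
  rw [cons_snoc_snoc_penultimateCol, Fin.cons_zero]

lemma colDet_apply_eq_zero {m : ℕ} (v : Fin m → Fin (m + 3) → ℝ) (i : Fin m)
    (u₁ u₂ : Fin (m + 3) → ℝ) : colDet (v i) v u₁ u₂ = 0 := by
  rw [colDet_eq_detRowAlternating]
  refine AlternatingMap.map_eq_zero_of_eq _ _ (i := 0) (j := i.castSucc.castSucc.succ) ?_
    (Fin.succ_ne_zero _).symm
  rw [Fin.cons_succ, Fin.snoc_castSucc (α := fun _ => Fin (m + 3) → ℝ),
    Fin.snoc_castSucc (α := fun _ => Fin (m + 3) → ℝ), Fin.cons_zero]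

lemma colDet_swap {m : ℕ} (w : Fin (m + 3) → ℝ) (v : Fin m → Fin (m + 3) → ℝ)
    (u₁ u₂ : Fin (m + 3) → ℝ) : colDet u₁ v w u₂ = -colDet w v u₁ u₂ := by
  rw [colDet_eq_detRowAlternating, colDet_eq_detRowAlternating,
    ← AlternatingMap.map_swap _ _ (Fin.succ_ne_zero (Fin.last m).castSucc).symm,
    Equiv.comp_swap_eq_update]
  rw [show (Fin.last m).castSucc.succ = penultimateCol m from rfl, update_cons_snoc_snoc,
    cons_snoc_snoc_penultimateCol, Fin.cons_zero, Fin.update_cons_zero]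

/-- for the Nambu-type system `wᵀf(x) = det(w, v₁,…,v_{n−3}, ∇H, ∇K)`
with `H = ℓ₁ℓ₂` a product of linear forms (so `∇H = ℓ₂a₁ + ℓ₁a₂`) and `∇K(x) = Cx`,
any pair `x, x̃` satisfying the Kahan–Hirota–Kimura relation satisfies, with
`Δ(y) = det(a₁, v₁,…,v_{n−3}, a₂, Cy)`:
`ℓ₁(x̃)(1−εΔ(x)) = ℓ₁(x)(1+εΔ(x̃))`, `ℓ₂(x̃)(1+εΔ(x)) = ℓ₂(x)(1−εΔ(x̃))`, hence
`H_ε = ℓ₁ℓ₂/(1−ε²Δ²)` is conserved; moreover `vᵢᵀx̃ = vᵢᵀx`. -/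
theorem khk_nambu_split_H (m : ℕ) (a₁ a₂ : Fin (m + 3) → ℝ)
    (C : Matrix (Fin (m + 3)) (Fin (m + 3)) ℝ) (hC : Cᵀ = C)
    (v : Fin m → Fin (m + 3) → ℝ)
    (ℓ₁ ℓ₂ : (Fin (m + 3) → ℝ) → ℝ)
    (hℓ₁ : ℓ₁ = fun x => a₁ ⬝ᵥ x) (hℓ₂ : ℓ₂ = fun x => a₂ ⬝ᵥ x)
    (Δ : (Fin (m + 3) → ℝ) → ℝ) (hΔ : Δ = fun y => colDet a₁ v a₂ (C *ᵥ y))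
    (ε : ℝ) (x x' : Fin (m + 3) → ℝ)
    (hkhk : ∀ w : Fin (m + 3) → ℝ, w ⬝ᵥ (x' - x) =
      ε * (colDet w v (ℓ₂ x • a₁ + ℓ₁ x • a₂) (C *ᵥ x') +
           colDet w v (ℓ₂ x' • a₁ + ℓ₁ x' • a₂) (C *ᵥ x))) :
    ℓ₁ x' * (1 - ε * Δ x) = ℓ₁ x * (1 + ε * Δ x') ∧
    ℓ₂ x' * (1 + ε * Δ x) = ℓ₂ x * (1 - ε * Δ x') ∧
    ℓ₁ x' * ℓ₂ x' * (1 - ε ^ 2 * (Δ x) ^ 2) =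
      ℓ₁ x * ℓ₂ x * (1 - ε ^ 2 * (Δ x') ^ 2) ∧
    (∀ i, v i ⬝ᵥ x' = v i ⬝ᵥ x) := by
  have key₁ : ℓ₁ x' * (1 - ε * Δ x) = ℓ₁ x * (1 + ε * Δ x') := by
    have h := hkhk a₁
    simp only [colDet_smul_add_smul, colDet_self, dotProduct_sub] at h
    subst hℓ₁ hℓ₂ hΔ
    linear_combination h
  have key₂ : ℓ₂ x' * (1 + ε * Δ x) = ℓ₂ x * (1 - ε * Δ x') := by
    have h := hkhk a₂
    simp only [colDet_smul_add_smul, colDet_self, colDet_swap a₁, dotProduct_sub] at h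
    subst hℓ₁ hℓ₂ hΔ
    linear_combination h
  refine ⟨key₁, key₂, ?_, fun i => ?_⟩
  · linear_combination ℓ₂ x' * (1 + ε * Δ x) * key₁ + ℓ₁ x * (1 + ε * Δ x') * key₂
  · have h := hkhk (v i)
    rw [colDet_apply_eq_zero, colDet_apply_eq_zero, dotProduct_sub] at h
    linear_combination h
end

section
/- Let ℓ be a linear form on ℝⁿ, ℓ(x)=aᵀx, let H(x)=(1/2)xᵀAx be a quadratic form (A symmetric), let J be a skew-symmetric real n×n matrix, and consider the quadratic vector field f(x)=ℓ(x)JAx − H(x)Ja. Suppose x,x̃∈ℝⁿ satisfy the Kahan–Hirota–Kimura relation x̃−x = ε( ℓ(x) J A x̃ + ℓ(x̃) J A x − (x̃ᵀAx) J a ). Then ℓ(x) H(x̃) = ℓ(x̃) H(x). In particular the Kahan–Hirota–Kimura discretization of ẋ=ℓ²J∇(H/ℓ) preserves the rational first integral F=H/ℓ exactly: F(x̃)=F(x) wherever ℓ(x),ℓ(x̃)≠0. -/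
open Matrix

/-- The quadratic form of a skew-symmetric real matrix vanishes. -/
theorem dotProduct_mulVec_self_of_transpose_eq_neg_s14 {ι : Type*} [Fintype ι]
    {J : Matrix ι ι ℝ} (hJ : Jᵀ = -J) (w : ι → ℝ) : w ⬝ᵥ (J *ᵥ w) = 0 := by
  have h : w ⬝ᵥ (J *ᵥ w) = -(w ⬝ᵥ (J *ᵥ w)) := by
    conv_lhs => rw [dotProduct_mulVec, ← mulVec_transpose, hJ, neg_mulVec, neg_dotProduct,
      dotProduct_comm]
  linarith

/-- The bilinear form of a symmetric matrix is symmetric. -/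
theorem dotProduct_mulVec_comm_of_transpose_eq_s14 {ι : Type*} [Fintype ι]
    {A : Matrix ι ι ℝ} (hA : Aᵀ = A) (x y : ι → ℝ) : x ⬝ᵥ (A *ᵥ y) = y ⬝ᵥ (A *ᵥ x) := by
  rw [dotProduct_mulVec, ← mulVec_transpose, hA, dotProduct_comm]

/-- the Kahan–Hirota–Kimura discretization of the vector field
`f(x) = ℓ(x)JAx − H(x)Ja = ℓ²J∇(H/ℓ)` (with `ℓ(x) = aᵀx`, `H(x) = (1/2)xᵀAx`,
`A` symmetric, `J` skew-symmetric) preserves the rational first integral `F = H/ℓ`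
exactly: if `x̃ − x = ε(ℓ(x)JAx̃ + ℓ(x̃)JAx − (x̃ᵀAx)Ja)`, then
`ℓ(x)H(x̃) = ℓ(x̃)H(x)`, hence `F(x̃) = F(x)` wherever `ℓ(x), ℓ(x̃) ≠ 0`. -/
theorem khk_rational_integral (n : ℕ) (a : Fin n → ℝ)
    (A : Matrix (Fin n) (Fin n) ℝ) (hA : Aᵀ = A)
    (J : Matrix (Fin n) (Fin n) ℝ) (hJ : Jᵀ = -J)
    (ℓ : (Fin n → ℝ) → ℝ) (hℓ : ℓ = fun x => a ⬝ᵥ x)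
    (H : (Fin n → ℝ) → ℝ) (hH : H = fun x => (1 / 2 : ℝ) * (x ⬝ᵥ (A *ᵥ x)))
    (ε : ℝ) (x x' : Fin n → ℝ)
    (hkhk : x' - x = ε • (ℓ x • (J *ᵥ (A *ᵥ x')) + ℓ x' • (J *ᵥ (A *ᵥ x)) -
      (x' ⬝ᵥ (A *ᵥ x)) • (J *ᵥ a))) :
    ℓ x * H x' = ℓ x' * H x ∧
    (ℓ x ≠ 0 → ℓ x' ≠ 0 → H x' / ℓ x' = H x / ℓ x) := by
  subst hℓ hH
  dsimp only at hkhk ⊢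
  have hw : x' - x = ε • (J *ᵥ ((a ⬝ᵥ x) • (A *ᵥ x') + (a ⬝ᵥ x') • (A *ᵥ x) -
      (x' ⬝ᵥ (A *ᵥ x)) • a)) := by
    rw [hkhk, mulVec_sub, mulVec_add, mulVec_smul, mulVec_smul, mulVec_smul]
  have h0 : ((a ⬝ᵥ x) • (A *ᵥ x') + (a ⬝ᵥ x') • (A *ᵥ x) -
      (x' ⬝ᵥ (A *ᵥ x)) • a) ⬝ᵥ (x' - x) = 0 := by
    rw [hw, dotProduct_smul, dotProduct_mulVec_self_of_transpose_eq_neg_s14 hJ, smul_zero]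
  simp only [sub_dotProduct, add_dotProduct, smul_dotProduct, dotProduct_sub, smul_eq_mul,
    dotProduct_comm (A *ᵥ x'), dotProduct_comm (A *ᵥ x),
    dotProduct_mulVec_comm_of_transpose_eq_s14 hA x x'] at h0
  have key : (a ⬝ᵥ x) * (1 / 2 * (x' ⬝ᵥ (A *ᵥ x'))) =
      (a ⬝ᵥ x') * (1 / 2 * (x ⬝ᵥ (A *ᵥ x))) := by
    linarith
  refine ⟨key, fun hx hx' => ?_⟩
  rw [div_eq_div_iff hx' hx]
  linarith
end

section
/- Let a₁,a₂,a₃∈ℝ and consider the degenerate Halphen system on ℝ³: ẋ₁=(1/2)(a₁+a₂+a₃)x₁² + (1/2)(a₁−a₂−a₃)(x₁−x₂)(x₁−x₃), ẋ₂=(1/2)(a₁+a₂+a₃)x₂² + (1/2)(a₂−a₃−a₁)(x₂−x₃)(x₂−x₁), ẋ₃=(1/2)(a₁+a₂+a₃)x₃² + (1/2)(a₃−a₁−a₂)(x₃−x₁)(x₃−x₂). Set N(x)=a₁(x₁x₂−x₂x₃+x₃x₁)+a₂(x₂x₃−x₃x₁+x₁x₂)+a₃(x₃x₁−x₁x₂+x₂x₃).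 Then for each pair i≠j the rational function F_{ij}=N/(xᵢ−xⱼ) is a first integral of the system: at every point with xᵢ≠xⱼ, the derivative of F_{ij} along the vector field vanishes; equivalently, the polynomial identity (xᵢ−xⱼ)·(∇N(x)ᵀ f(x)) − N(x)·(fᵢ(x)−fⱼ(x)) = 0 holds identically on ℝ³, where f denotes the right-hand side of the system. -/
/-- The right-hand side of the degenerate Halphen system (the Halphen system with
`λ = (a₁+a₂+a₃)/2`), as a vector field on ℝ³. -/
noncomputable def halphenField (a₁ a₂ a₃ : ℝ) (x : Fin 3 → ℝ) : Fin 3 → ℝ :=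
  ![(1 / 2 : ℝ) * (a₁ + a₂ + a₃) * (x 0) ^ 2 +
      (1 / 2 : ℝ) * (a₁ - a₂ - a₃) * (x 0 - x 1) * (x 0 - x 2),
    (1 / 2 : ℝ) * (a₁ + a₂ + a₃) * (x 1) ^ 2 +
      (1 / 2 : ℝ) * (a₂ - a₃ - a₁) * (x 1 - x 2) * (x 1 - x 0),
    (1 / 2 : ℝ) * (a₁ + a₂ + a₃) * (x 2) ^ 2 +
      (1 / 2 : ℝ) * (a₃ - a₁ - a₂) * (x 2 - x 0) * (x 2 - x 1)]

/-- The quadratic form `N` appearing in the integrals of the degenerate Halphen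
system. -/
noncomputable def halphenN (a₁ a₂ a₃ : ℝ) (x : Fin 3 → ℝ) : ℝ :=
  a₁ * (x 0 * x 1 - x 1 * x 2 + x 2 * x 0) +
  a₂ * (x 1 * x 2 - x 2 * x 0 + x 0 * x 1) +
  a₃ * (x 2 * x 0 - x 0 * x 1 + x 1 * x 2)

/-- The derivative of the coordinate quadratic form `N` in the direction `v`. -/
theorem hasFDerivAt_halphenN (a₁ a₂ a₃ : ℝ) (x : Fin 3 → ℝ) :
    ∃ L : (Fin 3 → ℝ) →L[ℝ] ℝ, HasFDerivAt (halphenN a₁ a₂ a₃) L x ∧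
      ∀ v, L v =
        a₁ * (x 0 * v 1 + x 1 * v 0 - (x 1 * v 2 + x 2 * v 1) + (x 2 * v 0 + x 0 * v 2)) +
        a₂ * (x 1 * v 2 + x 2 * v 1 - (x 2 * v 0 + x 0 * v 2) + (x 0 * v 1 + x 1 * v 0)) +
        a₃ * (x 2 * v 0 + x 0 * v 2 - (x 0 * v 1 + x 1 * v 0) + (x 1 * v 2 + x 2 * v 1)) := by
  have h := fun i : Fin 3 => hasFDerivAt_apply (𝕜 := ℝ) i x
  have h01 := (h 0).mul (h 1)
  have h12 := (h 1).mul (h 2)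
  have h20 := (h 2).mul (h 0)
  refine ⟨_, ((((h01.sub h12).add h20).const_mul a₁).add
    (((h12.sub h20).add h01).const_mul a₂)).add (((h20.sub h01).add h12).const_mul a₃), ?_⟩
  intro v
  simp
  ring

/-- `N` is a Darboux polynomial of the degenerate Halphen system, with cofactor
`a₁x₁ + a₂x₂ + a₃x₃`. -/
theorem fderiv_halphenN_halphenField (a₁ a₂ a₃ : ℝ) (x : Fin 3 → ℝ) :
    fderiv ℝ (halphenN a₁ a₂ a₃) x (halphenField a₁ a₂ a₃ x) =
      (a₁ * x 0 + a₂ * x 1 + a₃ * x 2) * halphenN a₁ a₂ a₃ x := by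
  obtain ⟨L, hL, hv⟩ := hasFDerivAt_halphenN a₁ a₂ a₃ x
  rw [hL.fderiv, hv]
  simp [halphenField, halphenN]
  ring

/-- The differences `xᵢ − xⱼ` are Darboux polynomials of the degenerate Halphen system, with
the same cofactor as `N`. -/
theorem halphenField_sub (a₁ a₂ a₃ : ℝ) (x : Fin 3 → ℝ) (i j : Fin 3) :
    halphenField a₁ a₂ a₃ x i - halphenField a₁ a₂ a₃ x j =
      (a₁ * x 0 + a₂ * x 1 + a₃ * x 2) * (x i - x j) := by
  fin_cases i <;> fin_cases j <;> simp [halphenField] <;> ring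

/-- for every pair of distinct indices `i ≠ j`, the rational function
`F_{ij} = N/(xᵢ − xⱼ)` is a first integral of the degenerate Halphen system: its
derivative along the vector field vanishes wherever `xᵢ ≠ xⱼ`, and the polynomial
identity `(xᵢ−xⱼ)(∇N(x)ᵀf(x)) − N(x)(fᵢ(x)−fⱼ(x)) = 0` holds identically on ℝ³. -/
theorem halphen_degenerate_integrals (a₁ a₂ a₃ : ℝ) :
    ∀ i j : Fin 3, i ≠ j →
      (∀ x : Fin 3 → ℝ, x i ≠ x j →
        fderiv ℝ (fun y => halphenN a₁ a₂ a₃ y / (y i - y j)) x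
          (halphenField a₁ a₂ a₃ x) = 0) ∧
      (∀ x : Fin 3 → ℝ,
        (x i - x j) * fderiv ℝ (halphenN a₁ a₂ a₃) x (halphenField a₁ a₂ a₃ x) -
          halphenN a₁ a₂ a₃ x *
            (halphenField a₁ a₂ a₃ x i - halphenField a₁ a₂ a₃ x j) = 0) := by
  intro i j _
  refine ⟨fun x hx => ?_, fun x => ?_⟩
  · have hN : HasFDerivAt (halphenN a₁ a₂ a₃) (fderiv ℝ (halphenN a₁ a₂ a₃) x) x := by
      obtain ⟨L, hL, -⟩ := hasFDerivAt_halphenN a₁ a₂ a₃ x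
      exact hL.differentiableAt.hasFDerivAt
    have hd := (hasFDerivAt_apply (𝕜 := ℝ) i x).sub (hasFDerivAt_apply (𝕜 := ℝ) j x)
    have hne : x i - x j ≠ 0 := sub_ne_zero.mpr hx
    have hq : HasFDerivAt (fun y => halphenN a₁ a₂ a₃ y / (y i - y j)) _ x :=
      hN.mul ((hasDerivAt_inv hne).comp_hasFDerivAt x hd)
    rw [hq.fderiv]
    simp [fderiv_halphenN_halphenField, halphenField_sub]
    field_simp
    ring
  · rw [fderiv_halphenN_halphenField, halphenField_sub]
    ring
end
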